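/- arXiv:1207.5440 — 2 statements merged into one kernel-verified Lean document; each statement's English description precedes it below -/
import Mathlib

section
/- Let U ⊆ ℝ⁴ be a contractible open set and let a, b : U → ℝ be smooth functions. Then the pair of equations X³b = (X²Y + XZ + W)a and Y²a = (YX − Z)b holds on U if and only if there exists a smooth function f : U → ℝ with Xf = a and Yf = b on U (local exactness of the Engel complex in degree one). -/
/-- Engel operator `X = ∂/∂x` on `ℝ⁴` with coordinates `(x, y, z, t)`. -/
noncomputable def opX (f : (Fin 4 → ℝ) → ℝ) : (Fin 4 → ℝ) → ℝ :=
  fun p => fderiv ℝ f p ![1, 0, 0, 0]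

/-- Engel operator `Y = ∂/∂z + x ∂/∂t + x² ∂/∂y` on `ℝ⁴`. -/
noncomputable def opY (f : (Fin 4 → ℝ) → ℝ) : (Fin 4 → ℝ) → ℝ :=
  fun p => fderiv ℝ f p ![0, (p 0) ^ 2, 1, p 0]

/-- Engel operator `Z = [X, Y] = ∂/∂t + 2x ∂/∂y` on `ℝ⁴`. -/
noncomputable def opZ (f : (Fin 4 → ℝ) → ℝ) : (Fin 4 → ℝ) → ℝ :=
  fun p => fderiv ℝ f p ![0, 2 * p 0, 0, 1]

/-- Engel operator `W = [X, Z] = 2 ∂/∂y` on `ℝ⁴`. -/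
noncomputable def opW (f : (Fin 4 → ℝ) → ℝ) : (Fin 4 → ℝ) → ℝ :=
  fun p => fderiv ℝ f p ![0, 2, 0, 0]

section

open Set Topology Filter

/-- On a simply connected, locally path connected space, functions given locally up to locally
constant functions come from a global function. -/
theorem exists_global_of_locally_constant_differences {X A : Type*} [TopologicalSpace X]
    [SimplyConnectedSpace X] [LocallyPathConnectedSpace X] [AddCommGroup A]
    (V : X → Set X) (hVo : ∀ i, IsOpen (V i)) (hV : ∀ i, i ∈ V i) (g : X → X → A)
    (hg : ∀ i j, ∀ x ∈ V i ∩ V j, ∀ᶠ y in 𝓝 x, g j y - g i y = g j x - g i x) :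
    ∃ f : X → A, ∀ i, ∀ᶠ y in 𝓝 i, f y - g i y = f i - g i i := by
  let _ : TopologicalSpace A := ⊥
  have : DiscreteTopology A := ⟨rfl⟩
  let B : FiberBundleCore X X A :=
    { baseSet := V
      isOpen_baseSet := hVo
      indexAt := id
      mem_baseSet_at := hV
      coordChange := fun i j x v => v + (g i x - g j x)
      coordChange_self := by simp
      continuousOn_coordChange := by
        rintro i j ⟨x, v⟩ ⟨hx, -⟩
        refine ContinuousAt.continuousWithinAt ?_
        refine (continuousAt_const (y := v + (g i x - g j x))).congr ?_
        have h1 := hg j i x ⟨hx.2, hx.1⟩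
        have h2 : ∀ᶠ w in 𝓝 v, w = v := by simp [nhds_discrete]
        filter_upwards [h1.prod_nhds h2] with p hp
        rw [hp.1, hp.2]
      coordChange_comp := by
        intro i j k x _ v
        abel }
  have cov : IsCoveringMap (Bundle.TotalSpace.proj : Bundle.TotalSpace A B.Fiber → X) :=
    FiberBundle.isCoveringMap
  obtain ⟨x₀⟩ : Nonempty X := inferInstance
  obtain ⟨s, ⟨-, hs⟩, -⟩ := cov.existsUnique_continuousMap_lifts (ContinuousMap.id X) x₀
    ⟨x₀, (0 : A)⟩ rfl
  have hs' : ∀ y, (s y).1 = y := fun y => congrFun hs y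
  let c : X → A := fun y => (s y).2
  refine ⟨fun y => c y + g y y, fun i => ?_⟩
  have key : ∀ y, (B.localTriv i (s y)).2 = c y + g y y - g i y := by
    intro y
    have : (B.localTriv i (s y)).2 = c y + (g (s y).1 (s y).1 - g i (s y).1) := rfl
    rw [this, hs' y]
    abel
  have hcont : ContinuousAt (fun y => (B.localTriv i (s y)).2) i := by
    refine continuousAt_snd.comp
      (ContinuousAt.comp (g := B.localTriv i) ?_ s.continuous.continuousAt)
    refine (B.localTriv i).toOpenPartialHomeomorph.continuousAt ?_
    refine (B.mem_localTriv_source i (s i)).2 ?_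
    rw [hs' i]
    exact hV i
  have := hcont.eventually (p := fun w => w = (B.localTriv i (s i)).2) (by simp [nhds_discrete])
  filter_upwards [this] with y hy
  rw [← key, hy, key]

/-- A smooth closed `1`-form on a simply connected open set is the differential of a smooth
function. -/
theorem exists_contDiffOn_hasFDerivAt_of_fderiv_symmetric {E : Type*} [NormedAddCommGroup E]
    [NormedSpace ℝ E] {U : Set E} (hU : IsOpen U) [SimplyConnectedSpace U]
    {ω : E → E →L[ℝ] ℝ} (hω : ContDiffOn ℝ (⊤ : ℕ∞) ω U)
    (hsymm : ∀ p ∈ U, ∀ u v, fderiv ℝ ω p u v = fderiv ℝ ω p v u) :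
    ∃ f : E → ℝ, ContDiffOn ℝ (⊤ : ℕ∞) f U ∧ ∀ p ∈ U, HasFDerivAt f (ω p) p := by
  classical
  have := hU.locallyPathConnectedSpace
  choose r hr hrU using fun i : U => Metric.isOpen_iff.1 hU i i.2
  have hloc : ∀ i : U, ∃ f : E → ℝ, ∀ p ∈ Metric.ball (i : E) (r i), HasFDerivAt f (ω p) p :=
    fun i => (convex_ball _ _).exists_forall_hasFDerivAt_of_fderiv_symmetric Metric.isOpen_ball
      ((hω.differentiableOn (by simp)).mono (hrU i)) fun p hp => hsymm p (hrU i hp)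
  choose g hg using hloc
  obtain ⟨F, hF⟩ := exists_global_of_locally_constant_differences
    (fun i : U => ((↑) : U → E) ⁻¹' Metric.ball (i : E) (r i))
    (fun i => Metric.isOpen_ball.preimage continuous_subtype_val)
    (fun i => Metric.mem_ball_self (hr i)) (fun i x => g i x) (by
      rintro i j x ⟨hxi, hxj⟩
      have hopen : IsOpen (Metric.ball (i : E) (r i) ∩ Metric.ball (j : E) (r j)) :=
        Metric.isOpen_ball.inter Metric.isOpen_ball
      have hd : ∀ p ∈ Metric.ball (i : E) (r i) ∩ Metric.ball (j : E) (r j),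
          HasFDerivAt (fun q => g j q - g i q) (0 : E →L[ℝ] ℝ) p := fun p hp =>
        sub_self (ω p) ▸ (hg j p hp.2).sub (hg i p hp.1)
      filter_upwards [(hopen.preimage continuous_subtype_val).mem_nhds
        (show x ∈ _ from ⟨hxi, hxj⟩)] with y hy
      exact ((convex_ball _ _).inter (convex_ball _ _)).is_const_of_fderivWithin_eq_zero (𝕜 := ℝ)
        (fun p hp => (hd p hp).differentiableAt.differentiableWithinAt)
        (fun p hp => (hd p hp).hasFDerivWithinAt.fderivWithin (hopen.uniqueDiffOn p hp))
        hy ⟨hxi, hxj⟩)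
  let f : E → ℝ := fun p => if h : p ∈ U then F ⟨p, h⟩ else 0
  have hf : ∀ p ∈ U, HasFDerivAt f (ω p) p := by
    intro p hp
    refine ((hg ⟨p, hp⟩ p (Metric.mem_ball_self (hr ⟨p, hp⟩))).add_const
      (F ⟨p, hp⟩ - g ⟨p, hp⟩ p)).congr_of_eventuallyEq ?_
    have h1 := hF ⟨p, hp⟩
    rw [nhds_subtype_eq_comap, eventually_comap] at h1
    filter_upwards [h1, hU.mem_nhds hp] with q hq hqU
    have := hq ⟨q, hqU⟩ rfl
    simp only [f, hqU, dite_true]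
    linear_combination this
  refine ⟨f, (contDiffOn_infty_iff_fderiv_of_isOpen hU).2
    ⟨fun p hp => (hf p hp).differentiableAt.differentiableWithinAt, ?_⟩, hf⟩
  exact hω.congr fun p hp => (hf p hp).fderiv

end

section

variable {E : Type*} [NormedAddCommGroup E] [NormedSpace ℝ E] {U : Set E} {f g : E → ℝ}
  {V W : E → E}

/-- The derivative of a function along a vector field. -/
noncomputable def derivAlong (V : E → E) (f : E → ℝ) : E → ℝ :=
  fun p => fderiv ℝ f p (V p)

theorem ContDiffOn.derivAlong (hf : ContDiffOn ℝ (⊤ : ℕ∞) f U) (hU : IsOpen U)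
    (hV : ContDiff ℝ (⊤ : ℕ∞) V) : ContDiffOn ℝ (⊤ : ℕ∞) (derivAlong V f) U :=
  ((contDiffOn_infty_iff_fderiv_of_isOpen hU).1 hf).2.clm_apply hV.contDiffOn

theorem ContDiffOn.differentiableAt_of_mem (hf : ContDiffOn ℝ (⊤ : ℕ∞) f U) (hU : IsOpen U)
    {p : E} (hp : p ∈ U) : DifferentiableAt ℝ f p :=
  (hf.differentiableOn (by simp)).differentiableAt (hU.mem_nhds hp)

theorem derivAlong_congr (hU : IsOpen U) (h : Set.EqOn f g U) :
    Set.EqOn (derivAlong V f) (derivAlong V g) U := fun p hp => by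
  have : f =ᶠ[nhds p] g := Filter.eventuallyEq_of_mem (hU.mem_nhds hp) h
  simp only [derivAlong, this.fderiv_eq]

theorem derivAlong_add (hU : IsOpen U) (hf : ContDiffOn ℝ (⊤ : ℕ∞) f U)
    (hg : ContDiffOn ℝ (⊤ : ℕ∞) g U) :
    Set.EqOn (derivAlong V (f + g)) (derivAlong V f + derivAlong V g) U := fun p hp => by
  simp [derivAlong, fderiv_add (hf.differentiableAt_of_mem hU hp)
    (hg.differentiableAt_of_mem hU hp)]

theorem derivAlong_sub (hU : IsOpen U) (hf : ContDiffOn ℝ (⊤ : ℕ∞) f U)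
    (hg : ContDiffOn ℝ (⊤ : ℕ∞) g U) :
    Set.EqOn (derivAlong V (f - g)) (derivAlong V f - derivAlong V g) U := fun p hp => by
  simp [derivAlong, fderiv_sub (hf.differentiableAt_of_mem hU hp)
    (hg.differentiableAt_of_mem hU hp)]

theorem derivAlong_comm (hU : IsOpen U) (hf : ContDiffOn ℝ (⊤ : ℕ∞) f U) {p : E} (hp : p ∈ U)
    {V' W' : E →L[ℝ] E} (hV : HasFDerivAt V V' p) (hW : HasFDerivAt W W' p) :
    derivAlong V (derivAlong W f) p =
      derivAlong W (derivAlong V f) p + fderiv ℝ f p (W' (V p) - V' (W p)) := by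
  have hd : DifferentiableAt ℝ (fderiv ℝ f) p :=
    (((contDiffOn_infty_iff_fderiv_of_isOpen hU).1 hf).2.differentiableOn
      (by simp)).differentiableAt (hU.mem_nhds hp)
  have hs : IsSymmSndFDerivAt ℝ f p :=
    (hf.contDiffAt (hU.mem_nhds hp)).isSymmSndFDerivAt (by
      simpa using WithTop.coe_le_coe.2 (le_top : (2 : ℕ∞) ≤ ⊤))
  have h1 := (hd.hasFDerivAt.clm_apply hW).fderiv
  have h2 := (hd.hasFDerivAt.clm_apply hV).fderiv
  unfold derivAlong
  rw [h1, h2]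
  simp [hs.eq (V p) (W p)]
  ring

end

section

/-- The vector field of `opX`. -/
def fieldX : (Fin 4 → ℝ) → Fin 4 → ℝ := fun _ => ![1, 0, 0, 0]

/-- The vector field of `opY`. -/
def fieldY : (Fin 4 → ℝ) → Fin 4 → ℝ := fun p => ![0, (p 0) ^ 2, 1, p 0]

/-- The vector field of `opZ`. -/
def fieldZ : (Fin 4 → ℝ) → Fin 4 → ℝ := fun p => ![0, 2 * p 0, 0, 1]

/-- The vector field of `opW`. -/
def fieldW : (Fin 4 → ℝ) → Fin 4 → ℝ := fun _ => ![0, 2, 0, 0]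

theorem contDiff_fieldX : ContDiff ℝ (⊤ : ℕ∞) fieldX := contDiff_const

theorem contDiff_fieldY : ContDiff ℝ (⊤ : ℕ∞) fieldY := by
  refine contDiff_pi.2 fun i => ?_
  fin_cases i <;> simp [fieldY] <;> fun_prop

theorem contDiff_fieldZ : ContDiff ℝ (⊤ : ℕ∞) fieldZ := by
  refine contDiff_pi.2 fun i => ?_
  fin_cases i <;> simp [fieldZ] <;> fun_prop

theorem contDiff_fieldW : ContDiff ℝ (⊤ : ℕ∞) fieldW := contDiff_const

theorem hasFDerivAt_fieldY (p : Fin 4 → ℝ) :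
    HasFDerivAt fieldY (ContinuousLinearMap.pi (![0, (2 * p 0) • .proj 0, 0, .proj 0] :
      Fin 4 → (Fin 4 → ℝ) →L[ℝ] ℝ)) p := by
  have h0 : HasFDerivAt (fun q : Fin 4 → ℝ => q 0)
      (ContinuousLinearMap.proj 0 : (Fin 4 → ℝ) →L[ℝ] ℝ) p := hasFDerivAt_apply 0 p
  refine hasFDerivAt_pi.2 fun i => ?_
  fin_cases i
  · exact hasFDerivAt_const _ _
  · simpa [fieldY] using h0.pow 2
  · exact hasFDerivAt_const _ _
  · exact h0

theorem hasFDerivAt_fieldZ (p : Fin 4 → ℝ) :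
    HasFDerivAt fieldZ (ContinuousLinearMap.pi (![0, (2 : ℝ) • .proj 0, 0, 0] :
      Fin 4 → (Fin 4 → ℝ) →L[ℝ] ℝ)) p := by
  have h0 : HasFDerivAt (fun q : Fin 4 → ℝ => q 0)
      (ContinuousLinearMap.proj 0 : (Fin 4 → ℝ) →L[ℝ] ℝ) p := hasFDerivAt_apply 0 p
  refine hasFDerivAt_pi.2 fun i => ?_
  fin_cases i
  · exact hasFDerivAt_const _ _
  · exact h0.const_mul 2
  · exact hasFDerivAt_const _ _
  · exact hasFDerivAt_const _ _

variable {U : Set (Fin 4 → ℝ)} {f : (Fin 4 → ℝ) → ℝ}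

theorem ContDiffOn.opX (hf : ContDiffOn ℝ (⊤ : ℕ∞) f U) (hU : IsOpen U) :
    ContDiffOn ℝ (⊤ : ℕ∞) (opX f) U := hf.derivAlong hU contDiff_fieldX

theorem ContDiffOn.opY (hf : ContDiffOn ℝ (⊤ : ℕ∞) f U) (hU : IsOpen U) :
    ContDiffOn ℝ (⊤ : ℕ∞) (opY f) U := hf.derivAlong hU contDiff_fieldY

theorem ContDiffOn.opZ (hf : ContDiffOn ℝ (⊤ : ℕ∞) f U) (hU : IsOpen U) :
    ContDiffOn ℝ (⊤ : ℕ∞) (opZ f) U := hf.derivAlong hU contDiff_fieldZ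

theorem ContDiffOn.opW (hf : ContDiffOn ℝ (⊤ : ℕ∞) f U) (hU : IsOpen U) :
    ContDiffOn ℝ (⊤ : ℕ∞) (opW f) U := hf.derivAlong hU contDiff_fieldW

theorem opX_opY (hU : IsOpen U) (hf : ContDiffOn ℝ (⊤ : ℕ∞) f U) :
    Set.EqOn (opX (opY f)) (opY (opX f) + opZ f) U := fun p hp => by
  refine (derivAlong_comm hU hf hp (hasFDerivAt_const _ p) (hasFDerivAt_fieldY p)).trans ?_
  refine congrArg (derivAlong fieldY (derivAlong fieldX f) p + fderiv ℝ f p ·) ?_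
  ext i
  fin_cases i <;> simp

theorem opX_opZ (hU : IsOpen U) (hf : ContDiffOn ℝ (⊤ : ℕ∞) f U) :
    Set.EqOn (opX (opZ f)) (opZ (opX f) + opW f) U := fun p hp => by
  refine (derivAlong_comm hU hf hp (hasFDerivAt_const _ p) (hasFDerivAt_fieldZ p)).trans ?_
  refine congrArg (derivAlong fieldZ (derivAlong fieldX f) p + fderiv ℝ f p ·) ?_
  ext i
  fin_cases i <;> simp

theorem opX_opW (hU : IsOpen U) (hf : ContDiffOn ℝ (⊤ : ℕ∞) f U) :
    Set.EqOn (opX (opW f)) (opW (opX f)) U := fun p hp => by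
  refine (derivAlong_comm hU hf hp (hasFDerivAt_const _ p) (hasFDerivAt_const _ p)).trans ?_
  simp
  rfl

theorem opY_opZ (hU : IsOpen U) (hf : ContDiffOn ℝ (⊤ : ℕ∞) f U) :
    Set.EqOn (opY (opZ f)) (opZ (opY f)) U := fun p hp => by
  refine (derivAlong_comm hU hf hp (hasFDerivAt_fieldY p) (hasFDerivAt_fieldZ p)).trans ?_
  refine (congrArg (derivAlong fieldZ (derivAlong fieldY f) p + fderiv ℝ f p ·)
    (a₂ := 0) ?_).trans (by rw [map_zero, add_zero]; rfl)
  ext i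
  fin_cases i <;> simp [fieldY, fieldZ]

theorem opY_opW (hU : IsOpen U) (hf : ContDiffOn ℝ (⊤ : ℕ∞) f U) :
    Set.EqOn (opY (opW f)) (opW (opY f)) U := fun p hp => by
  refine (derivAlong_comm hU hf hp (hasFDerivAt_fieldY p) (hasFDerivAt_const _ p)).trans ?_
  refine (congrArg (derivAlong fieldW (derivAlong fieldY f) p + fderiv ℝ f p ·)
    (a₂ := 0) ?_).trans (by rw [map_zero, add_zero]; rfl)
  ext i
  fin_cases i <;> simp [fieldY]

end

section

variable {U : Set (Fin 4 → ℝ)} {f a b c d : (Fin 4 → ℝ) → ℝ}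

/-- The `1`-form taking the values `a`, `b`, `c`, `d` on the frame `X`, `Y`, `Z`, `W`. -/
noncomputable def frameForm (a b c d : (Fin 4 → ℝ) → ℝ) (p : Fin 4 → ℝ) :
    (Fin 4 → ℝ) →L[ℝ] ℝ :=
  a p • .proj 0 + (d p / 2) • .proj 1 + (b p - p 0 * c p + p 0 ^ 2 / 2 * d p) • .proj 2 +
    (c p - p 0 * d p) • .proj 3

theorem frameForm_apply (p u : Fin 4 → ℝ) :
    frameForm a b c d p u = a p * u 0 + d p / 2 * u 1 +
      (b p - p 0 * c p + p 0 ^ 2 / 2 * d p) * u 2 + (c p - p 0 * d p) * u 3 := by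
  simp [frameForm]

theorem contDiffOn_frameForm (ha : ContDiffOn ℝ (⊤ : ℕ∞) a U) (hb : ContDiffOn ℝ (⊤ : ℕ∞) b U)
    (hc : ContDiffOn ℝ (⊤ : ℕ∞) c U) (hd : ContDiffOn ℝ (⊤ : ℕ∞) d U) :
    ContDiffOn ℝ (⊤ : ℕ∞) (frameForm a b c d) U := by
  have h0 : ContDiffOn ℝ (⊤ : ℕ∞) (fun p : Fin 4 → ℝ => p 0) U := by fun_prop
  unfold frameForm
  fun_prop

theorem fderiv_frameForm_apply {p : Fin 4 → ℝ} (ha : DifferentiableAt ℝ a p)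
    (hb : DifferentiableAt ℝ b p) (hc : DifferentiableAt ℝ c p) (hd : DifferentiableAt ℝ d p)
    (u v : Fin 4 → ℝ) :
    fderiv ℝ (frameForm a b c d) p u v = fderiv ℝ a p u * v 0 + fderiv ℝ d p u / 2 * v 1 +
      (fderiv ℝ b p u - (u 0 * c p + p 0 * fderiv ℝ c p u) +
        (p 0 * u 0 * d p + p 0 ^ 2 / 2 * fderiv ℝ d p u)) * v 2 +
      (fderiv ℝ c p u - (u 0 * d p + p 0 * fderiv ℝ d p u)) * v 3 := by
  have h0 : HasFDerivAt (fun q : Fin 4 → ℝ => q 0)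
      (ContinuousLinearMap.proj 0 : (Fin 4 → ℝ) →L[ℝ] ℝ) p := hasFDerivAt_apply 0 p
  have hsq := (h0.pow 2).mul_const (2⁻¹ : ℝ)
  have key := (((ha.hasFDerivAt.smul_const
      (ContinuousLinearMap.proj 0 : (Fin 4 → ℝ) →L[ℝ] ℝ)).add
    ((hd.hasFDerivAt.mul_const (2⁻¹ : ℝ)).smul_const
      (ContinuousLinearMap.proj 1 : (Fin 4 → ℝ) →L[ℝ] ℝ))).add
    (((hb.hasFDerivAt.sub (h0.mul hc.hasFDerivAt)).add (hsq.mul hd.hasFDerivAt)).smul_const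
      (ContinuousLinearMap.proj 2 : (Fin 4 → ℝ) →L[ℝ] ℝ))).add
    ((hc.hasFDerivAt.sub (h0.mul hd.hasFDerivAt)).smul_const
      (ContinuousLinearMap.proj 3 : (Fin 4 → ℝ) →L[ℝ] ℝ))
  have : HasFDerivAt (frameForm a b c d) _ p := key
  rw [this.fderiv]
  simp
  ring

theorem fderiv_apply_eq_frame (f : (Fin 4 → ℝ) → ℝ) (p u : Fin 4 → ℝ) :
    fderiv ℝ f p u = u 0 * opX f p + u 2 * opY f p + (u 3 - p 0 * u 2) * opZ f p +
      (u 1 - p 0 ^ 2 * u 2 - 2 * p 0 * (u 3 - p 0 * u 2)) / 2 * opW f p := by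
  have : u = u 0 • fieldX p + u 2 • fieldY p + (u 3 - p 0 * u 2) • fieldZ p +
      ((u 1 - p 0 ^ 2 * u 2 - 2 * p 0 * (u 3 - p 0 * u 2)) / 2) • fieldW p := by
    ext i
    fin_cases i <;> simp [fieldX, fieldY, fieldZ, fieldW] <;> ring
  conv_lhs => rw [this]
  simp only [map_add, map_smul, smul_eq_mul]
  rfl

theorem fderiv_frameForm_symm {p : Fin 4 → ℝ} (ha : DifferentiableAt ℝ a p)
    (hb : DifferentiableAt ℝ b p) (hc : DifferentiableAt ℝ c p) (hd : DifferentiableAt ℝ d p)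
    (hXY : opX b p = opY a p + c p) (hXZ : opX c p = opZ a p + d p) (hXW : opX d p = opW a p)
    (hYZ : opY c p = opZ b p) (hYW : opY d p = opW b p) (hZW : opZ d p = opW c p)
    (u v : Fin 4 → ℝ) :
    fderiv ℝ (frameForm a b c d) p u v = fderiv ℝ (frameForm a b c d) p v u := by
  rw [fderiv_frameForm_apply ha hb hc hd, fderiv_frameForm_apply ha hb hc hd]
  simp only [fderiv_apply_eq_frame _ p u, fderiv_apply_eq_frame _ p v, hXY, hXZ, hXW, hYZ, hYW,
    hZW]
  ring

theorem engel_equations_of_primitive (hU : IsOpen U) (hf : ContDiffOn ℝ (⊤ : ℕ∞) f U)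
    (ha : Set.EqOn (opX f) a U) (hb : Set.EqOn (opY f) b U) {p : Fin 4 → ℝ} (hp : p ∈ U) :
    opX (opX (opX b)) p = opX (opX (opY a)) p + opX (opZ a) p + opW a p ∧
      opY (opY a) p = opY (opX b) p - opZ b p := by
  have hX := fun {g h} => derivAlong_congr (f := g) (g := h) (V := fieldX) hU
  have hY := fun {g h} => derivAlong_congr (f := g) (g := h) (V := fieldY) hU
  have hZ := fun {g h} => derivAlong_congr (f := g) (g := h) (V := fieldZ) hU
  have hW := fun {g h} => derivAlong_congr (f := g) (g := h) (V := fieldW) hU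
  have hXb : Set.EqOn (opX b) (opY a + opZ f) U := fun q hq => by
    have h1 : opX (opY f) q = opX b q := hX hb hq
    have h2 : opY (opX f) q = opY a q := hY ha hq
    rw [← h1, opX_opY hU hf hq, Pi.add_apply, h2, Pi.add_apply]
  have hSa : ContDiffOn ℝ (⊤ : ℕ∞) a U := (hf.opX hU).congr ha.symm
  have hXZ : Set.EqOn (opX (opZ f)) (opZ a + opW f) U := fun q hq => by
    have h2 : opZ (opX f) q = opZ a q := hZ ha hq
    rw [opX_opZ hU hf hq, Pi.add_apply, h2, Pi.add_apply]
  have hXXb : Set.EqOn (opX (opX b)) (opX (opY a) + (opZ a + opW f)) U := fun q hq => by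
    have h1 : opX (opX b) q = opX (opY a + opZ f) q := hX hXb hq
    have h2 : opX (opY a + opZ f) q = (opX (opY a) + opX (opZ f)) q :=
      derivAlong_add (V := fieldX) hU (hSa.opY hU) (hf.opZ hU) hq
    rw [h1, h2, Pi.add_apply, hXZ hq, Pi.add_apply, Pi.add_apply, Pi.add_apply]
  constructor
  · have h1 : opX (opX (opX b)) p = opX (opX (opY a) + (opZ a + opW f)) p := hX hXXb hp
    have h2 : opX (opX (opY a) + (opZ a + opW f)) p =
        (opX (opX (opY a)) + opX (opZ a + opW f)) p :=
      derivAlong_add (V := fieldX) hU ((hSa.opY hU).opX hU) ((hSa.opZ hU).add (hf.opW hU)) hp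
    have h3 : opX (opZ a + opW f) p = (opX (opZ a) + opX (opW f)) p :=
      derivAlong_add (V := fieldX) hU (hSa.opZ hU) (hf.opW hU) hp
    have h4 : opW (opX f) p = opW a p := hW ha hp
    rw [h1, h2, Pi.add_apply, h3, Pi.add_apply, opX_opW hU hf hp, h4, add_assoc]
  · have h1 : opY (opX b) p = opY (opY a + opZ f) p := hY hXb hp
    have h2 : opY (opY a + opZ f) p = (opY (opY a) + opY (opZ f)) p :=
      derivAlong_add (V := fieldY) hU (hSa.opY hU) (hf.opZ hU) hp
    have h3 : opZ (opY f) p = opZ b p := hZ hb hp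
    rw [h1, h2, Pi.add_apply, opY_opZ hU hf hp, h3, add_sub_cancel_right]

/-- The Engel equations make the `1`-form with components `a`, `b`, `Xb - Ya`,
`X(Xb - Ya) - Za` closed. -/
theorem fderiv_frameForm_symm_of_engel_equations (hU : IsOpen U)
    (ha : ContDiffOn ℝ (⊤ : ℕ∞) a U) (hb : ContDiffOn ℝ (⊤ : ℕ∞) b U)
    (h : ∀ p ∈ U, opX (opX (opX b)) p = opX (opX (opY a)) p + opX (opZ a) p + opW a p ∧
      opY (opY a) p = opY (opX b) p - opZ b p)
    (hc : c = opX b - opY a) (hd : d = opX c - opZ a) {p : Fin 4 → ℝ} (hp : p ∈ U)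
    (u v : Fin 4 → ℝ) :
    fderiv ℝ (frameForm a b c d) p u v = fderiv ℝ (frameForm a b c d) p v u := by
  have hX := fun {g h} => derivAlong_congr (f := g) (g := h) (V := fieldX) hU
  have hY := fun {g h} => derivAlong_congr (f := g) (g := h) (V := fieldY) hU
  have hSc : ContDiffOn ℝ (⊤ : ℕ∞) c U := hc ▸ (hb.opX hU).sub (ha.opY hU)
  have hSd : ContDiffOn ℝ (⊤ : ℕ∞) d U := hd ▸ (hSc.opX hU).sub (ha.opZ hU)
  have hXc : Set.EqOn (opX c) (opX (opX b) - opX (opY a)) U :=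
    hc ▸ derivAlong_sub hU (hb.opX hU) (ha.opY hU)
  have hYc : Set.EqOn (opY c) (opY (opX b) - opY (opY a)) U :=
    hc ▸ derivAlong_sub hU (hb.opX hU) (ha.opY hU)
  have hZc : Set.EqOn (opZ c) (opZ (opX b) - opZ (opY a)) U :=
    hc ▸ derivAlong_sub hU (hb.opX hU) (ha.opY hU)
  have hWc : Set.EqOn (opW c) (opW (opX b) - opW (opY a)) U :=
    hc ▸ derivAlong_sub hU (hb.opX hU) (ha.opY hU)
  have hXd : Set.EqOn (opX d) (opX (opX c) - opX (opZ a)) U :=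
    hd ▸ derivAlong_sub hU (hSc.opX hU) (ha.opZ hU)
  have hYd : Set.EqOn (opY d) (opY (opX c) - opY (opZ a)) U :=
    hd ▸ derivAlong_sub hU (hSc.opX hU) (ha.opZ hU)
  have hXW : Set.EqOn (opX d) (opW a) U := fun q hq => by
    have h1 : opX (opX c) q = opX (opX (opX b) - opX (opY a)) q := hX hXc hq
    have h2 : opX (opX (opX b) - opX (opY a)) q =
        (opX (opX (opX b)) - opX (opX (opY a))) q :=
      derivAlong_sub (V := fieldX) hU ((hb.opX hU).opX hU) ((ha.opY hU).opX hU) hq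
    have h3 := hXd hq
    simp only [Pi.sub_apply] at h2 h3
    linear_combination h3 + h1 + h2 + (h q hq).1
  have hYZ : Set.EqOn (opY c) (opZ b) U := fun q hq => by
    have h1 := hYc hq
    simp only [Pi.sub_apply] at h1
    linear_combination h1 - (h q hq).2
  have hYW : Set.EqOn (opY d) (opW b) U := fun q hq => by
    have h1 := hYd hq
    have h2 := opX_opY hU hSc hq
    have h3 : opX (opY c) q = opX (opZ b) q := hX hYZ hq
    have h4 := opX_opZ hU hb hq
    have h5 := hZc hq
    have h6 := opY_opZ hU ha hq
    simp only [Pi.sub_apply, Pi.add_apply] at h1 h2 h4 h5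
    linear_combination h1 - h2 + h3 + h4 - h5 - h6
  have hZW : opZ d p = opW c p := by
    have h1 := opX_opY hU hSd hp
    have h2 : opX (opY d) p = opX (opW b) p := hX hYW hp
    have h3 : opY (opX d) p = opY (opW a) p := hY hXW hp
    have h4 := opX_opW hU hb hp
    have h5 := opY_opW hU ha hp
    have h6 := hWc hp
    simp only [Pi.sub_apply, Pi.add_apply] at h1 h6
    linear_combination -h1 + h2 - h3 + h4 - h5 - h6
  refine fderiv_frameForm_symm (ha.differentiableAt_of_mem hU hp)
    (hb.differentiableAt_of_mem hU hp) (hSc.differentiableAt_of_mem hU hp)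
    (hSd.differentiableAt_of_mem hU hp) ?_ ?_ (hXW hp) (hYZ hp) (hYW hp) hZW u v
  · simp [hc]
  · simp [hd]

end

theorem engel_integrability
    (U : Set (Fin 4 → ℝ)) (hU : IsOpen U) (hUc : ContractibleSpace U)
    (a b : (Fin 4 → ℝ) → ℝ)
    (ha : ContDiffOn ℝ (⊤ : ℕ∞) a U) (hb : ContDiffOn ℝ (⊤ : ℕ∞) b U) :
    (∀ p ∈ U, opX (opX (opX b)) p =
                opX (opX (opY a)) p + opX (opZ a) p + opW a p ∧
              opY (opY a) p = opY (opX b) p - opZ b p) ↔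
    (∃ f : (Fin 4 → ℝ) → ℝ, ContDiffOn ℝ (⊤ : ℕ∞) f U ∧
      ∀ p ∈ U, opX f p = a p ∧ opY f p = b p) := by
  have : SimplyConnectedSpace U := .ofContractible U
  constructor
  · intro h
    have hSc := (hb.opX hU).sub (ha.opY hU)
    have hSd := (hSc.opX hU).sub (ha.opZ hU)
    obtain ⟨f, hf, hf'⟩ := exists_contDiffOn_hasFDerivAt_of_fderiv_symmetric hU
      (contDiffOn_frameForm ha hb hSc hSd) fun p hp =>
        fderiv_frameForm_symm_of_engel_equations hU ha hb h rfl rfl hp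
    refine ⟨f, hf, fun p hp => ⟨?_, ?_⟩⟩
    · rw [opX, (hf' p hp).fderiv, frameForm_apply]
      simp
    · rw [opY, (hf' p hp).fderiv, frameForm_apply]
      simp
      ring
  · rintro ⟨f, hf, h⟩ p hp
    exact engel_equations_of_primitive hU hf (fun q hq => (h q hq).1) (fun q hq => (h q hq).2) hp
end

section
/- Let U ⊆ ℝ⁴ be a contractible open set and let c, d : U → ℝ be smooth functions satisfying X³d + (XY + Z)c = 0 and Y²c + (YX² − ZX + W)d = 0 on U. Then there exist smooth functions a, b : U → ℝ such that c = X³b − (X²Y + XZ + W)a and d = Y²a − (YX − Z)b on U (local exactness of the Engel complex in degree two). -/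
universe u

open Set Topology MeasureTheory
open scoped ContDiff Manifold

theorem ContinuousOn.comp_prodMk {α β γ : Type*} [TopologicalSpace α] [TopologicalSpace β]
    [TopologicalSpace γ] {U : Set α} {g : α × β → γ} (hg : ContinuousOn g (U ×ˢ univ))
    {x : α} (hx : x ∈ U) : Continuous fun t => g (x, t) :=
  hg.comp_continuous (by fun_prop) fun t => ⟨hx, mem_univ t⟩

theorem hasFDerivAt_intervalIntegral_of_contDiffOn {E F : Type*} [NormedAddCommGroup E]
    [NormedSpace ℝ E] [FiniteDimensional ℝ E] [NormedAddCommGroup F] [NormedSpace ℝ F]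
    {U : Set E} (hU : IsOpen U) {f : E × ℝ → F} (hf : ContDiffOn ℝ ∞ f (U ×ˢ univ))
    {p : E} (hp : p ∈ U) :
    HasFDerivAt (fun x => ∫ t in (0 : ℝ)..1, f (x, t))
      (∫ t in (0 : ℝ)..1, (fderiv ℝ f (p, t)).comp (.inl ℝ E ℝ)) p := by
  have hV : IsOpen (U ×ˢ (univ : Set ℝ)) := hU.prod isOpen_univ
  have hf' : ContinuousOn (fun q => (fderiv ℝ f q).comp (.inl ℝ E ℝ)) (U ×ˢ univ) :=
    (hf.continuousOn_fderiv_of_isOpen hV (by simp)).clm_comp continuousOn_const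
  obtain ⟨K, hK, hpK, hKU⟩ := exists_compact_subset hU hp
  obtain ⟨M, hM⟩ := (hK.prod (isCompact_Icc (a := (0 : ℝ)) (b := 1))).bddAbove_image
    (hf'.norm.mono (prod_mono hKU (subset_univ _)))
  refine intervalIntegral.hasFDerivAt_integral_of_dominated_of_fderiv_le
    (F := fun x t => f (x, t)) (bound := fun _ => M)
    (F' := fun x t => (fderiv ℝ f (x, t)).comp (.inl ℝ E ℝ)) (mem_interior_iff_mem_nhds.1 hpK)
    ?_ ?_ ?_ ?_ ?_ ?_
  · filter_upwards [hU.mem_nhds hp] with x hx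
    exact (hf.continuousOn.comp_prodMk hx).aestronglyMeasurable
  · exact (hf.continuousOn.comp_prodMk hp).intervalIntegrable _ _
  · exact (hf'.comp_prodMk hp).aestronglyMeasurable
  · refine .of_forall fun t ht x hx => hM ⟨(x, t), ⟨hx, ?_⟩, rfl⟩
    rw [uIoc_of_le zero_le_one] at ht
    exact Ioc_subset_Icc_self ht
  · simp
  · refine .of_forall fun t _ x hx => ?_
    have hxt : (x, t) ∈ U ×ˢ univ := ⟨hKU hx, mem_univ t⟩
    have h := ((hf.contDiffAt (hV.mem_nhds hxt)).differentiableAt (by simp)).hasFDerivAt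
    exact h.comp (f := fun y => (y, t)) x (hasFDerivAt_prodMk_left x t)

theorem contDiffOn_intervalIntegral {E F : Type u} [NormedAddCommGroup E]
    [NormedSpace ℝ E] [FiniteDimensional ℝ E] [NormedAddCommGroup F] [NormedSpace ℝ F]
    {U : Set E} (hU : IsOpen U) {f : E × ℝ → F} (hf : ContDiffOn ℝ ∞ f (U ×ˢ univ)) :
    ContDiffOn ℝ ∞ (fun x => ∫ t in (0 : ℝ)..1, f (x, t)) U := by
  have hV : IsOpen (U ×ˢ (univ : Set ℝ)) := hU.prod isOpen_univ
  refine contDiffOn_infty.2 fun n => ?_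
  induction n generalizing F with
  | zero =>
    exact contDiffOn_zero.2 fun p hp =>
      (hasFDerivAt_intervalIntegral_of_contDiffOn hU hf hp).continuousAt.continuousWithinAt
  | succ n ih =>
    rw [Nat.cast_add, Nat.cast_one, contDiffOn_succ_iff_fderiv_of_isOpen hU]
    refine ⟨fun p hp => (hasFDerivAt_intervalIntegral_of_contDiffOn hU
      hf hp).differentiableAt.differentiableWithinAt, by simp, ?_⟩
    exact (ih (f := fun q => (fderiv ℝ f q).comp (.inl ℝ E ℝ))
      ((hf.fderiv_of_isOpen hV (by simp)).clm_comp contDiffOn_const)).congr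
      fun p hp => (hasFDerivAt_intervalIntegral_of_contDiffOn hU hf hp).fderiv

theorem contDiff_flip {E F G : Type*} [NormedAddCommGroup E] [NormedSpace ℝ E]
    [NormedAddCommGroup F] [NormedSpace ℝ F] [NormedAddCommGroup G] [NormedSpace ℝ G] :
    ContDiff ℝ ∞ (fun L : E →L[ℝ] F →L[ℝ] G => L.flip) :=
  show ContDiff ℝ ∞ (ContinuousLinearMap.flipₗᵢ ℝ E F G) from LinearIsometryEquiv.contDiff _

/-- A field of alternating bilinear forms that is closed as a differential 2-form on `U`. -/
structure IsClosedTwoForm {E : Type*} [NormedAddCommGroup E] [NormedSpace ℝ E]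
    (σ : E → E →L[ℝ] E →L[ℝ] ℝ) (U : Set E) : Prop where
  contDiffOn : ContDiffOn ℝ ∞ σ U
  alternating : ∀ p ∈ U, ∀ u, σ p u u = 0
  closed : ∀ p ∈ U, ∀ u v w,
    fderiv ℝ (fun q => σ q v w) p u + fderiv ℝ (fun q => σ q w u) p v +
      fderiv ℝ (fun q => σ q u v) p w = 0

namespace IsClosedTwoForm

variable {E F : Type*} [NormedAddCommGroup E] [NormedSpace ℝ E]
  [NormedAddCommGroup F] [NormedSpace ℝ F] {σ : E → E →L[ℝ] E →L[ℝ] ℝ} {U : Set E}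

theorem antisymm (h : IsClosedTwoForm σ U) {p : E} (hp : p ∈ U) (u v : E) :
    σ p u v = -σ p v u := by
  have := h.alternating p hp (u + v)
  simp only [map_add, add_apply, h.alternating p hp] at this
  linarith

theorem contDiffOn_apply (h : IsClosedTwoForm σ U) (u v : E) :
    ContDiffOn ℝ ∞ (fun q => σ q u v) U :=
  (h.contDiffOn.clm_apply contDiffOn_const).clm_apply contDiffOn_const

theorem fderiv_antisymm (h : IsClosedTwoForm σ U) (hU : IsOpen U) {p : E} (hp : p ∈ U)
    (u v : E) : fderiv ℝ (fun q => σ q u v) p = -fderiv ℝ (fun q => σ q v u) p := by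
  rw [← fderiv_fun_neg]
  exact Filter.EventuallyEq.fderiv_eq
    (Filter.eventually_of_mem (hU.mem_nhds hp) fun q hq => h.antisymm hq u v)

theorem pullback (h : IsClosedTwoForm σ U) (hU : IsOpen U) {V : Set F} (hV : IsOpen V)
    {G : F → E} (hG : ContDiffOn ℝ ∞ G V) (hGU : MapsTo G V U) :
    IsClosedTwoForm (fun q => (σ (G q)).bilinearComp (fderiv ℝ G q) (fderiv ℝ G q)) V := by
  have hG' : ContDiffOn ℝ ∞ (fderiv ℝ G) V := hG.fderiv_of_isOpen hV (by simp)
  have hσG : ContDiffOn ℝ ∞ (fun q => σ (G q)) V := h.contDiffOn.comp hG hGU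
  have smooth : ContDiffOn ℝ ∞
      (fun q => (σ (G q)).bilinearComp (fderiv ℝ G q) (fderiv ℝ G q)) V :=
    contDiff_flip.comp_contDiffOn
      ((contDiff_flip.comp_contDiffOn (hσG.clm_comp hG')).clm_comp hG')
  refine ⟨smooth, fun q hq u => h.alternating _ (hGU hq) _, fun q hq u v w => ?_⟩
  have hVq := hV.mem_nhds hq
  have dG := ((hG.contDiffAt hVq).differentiableAt (by simp)).hasFDerivAt
  have dG' := ((hG'.contDiffAt hVq).differentiableAt (by simp)).hasFDerivAt
  have dσ := ((h.contDiffOn.contDiffAt (hU.mem_nhds (hGU hq))).differentiableAt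
    (by simp)).hasFDerivAt
  have formula (u v w : F) :
      fderiv ℝ (fun q => (σ (G q)).bilinearComp (fderiv ℝ G q) (fderiv ℝ G q) v w) q u =
        fderiv ℝ (fun x => σ x (fderiv ℝ G q v) (fderiv ℝ G q w)) (G q) (fderiv ℝ G q u)
        + σ (G q) (fderiv ℝ (fderiv ℝ G) q u v) (fderiv ℝ G q w)
        + σ (G q) (fderiv ℝ G q v) (fderiv ℝ (fderiv ℝ G) q u w) := by
    have h1 := (dσ.clm_apply (hasFDerivAt_const (fderiv ℝ G q v) (G q))).clm_apply
      (hasFDerivAt_const (fderiv ℝ G q w) (G q))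
    have h2 := ((dσ.comp q dG).clm_apply (dG'.clm_apply (hasFDerivAt_const v q))).clm_apply
      (dG'.clm_apply (hasFDerivAt_const w q))
    have h3 : fderiv ℝ (fun q => (σ (G q)).bilinearComp (fderiv ℝ G q) (fderiv ℝ G q) v w) q =
      _ := h2.fderiv
    rw [h1.fderiv, h3]
    simp [add_comm, add_left_comm]
  have symm (u v : F) : fderiv ℝ (fderiv ℝ G) q u v = fderiv ℝ (fderiv ℝ G) q v u :=
    ((hG.contDiffAt hVq).isSymmSndFDerivAt (by simpa using ENat.LEInfty.out)) u v
  rw [formula, formula, formula, symm v u, symm w u, symm w v]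
  have c := h.closed _ (hGU hq) (fderiv ℝ G q u) (fderiv ℝ G q v) (fderiv ℝ G q w)
  have a := h.antisymm (hGU hq)
  linarith [a (fderiv ℝ (fderiv ℝ G) q u v) (fderiv ℝ G q w),
    a (fderiv ℝ (fderiv ℝ G) q u w) (fderiv ℝ G q v),
    a (fderiv ℝ (fderiv ℝ G) q v w) (fderiv ℝ G q u)]

theorem exists_primitive_of_cylinder {E : Type u} [NormedAddCommGroup E] [NormedSpace ℝ E]
    [FiniteDimensional ℝ E] {U : Set E} (hU : IsOpen U)
    {Ω : E × ℝ → E × ℝ →L[ℝ] E × ℝ →L[ℝ] ℝ} (h : IsClosedTwoForm Ω (U ×ˢ univ)) :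
    ∃ η : E → E →L[ℝ] ℝ, ContDiffOn ℝ ∞ η U ∧ ∀ p ∈ U, ∀ u v,
      fderiv ℝ η p u v - fderiv ℝ η p v u =
        Ω (p, 1) (u, 0) (v, 0) - Ω (p, 0) (u, 0) (v, 0) := by
  have hV : IsOpen (U ×ˢ (univ : Set ℝ)) := hU.prod isOpen_univ
  let f : E × ℝ → E →L[ℝ] ℝ := fun q => (Ω q (0, 1)).comp (.inl ℝ E ℝ)
  have hf : ContDiffOn ℝ ∞ f (U ×ˢ univ) :=
    (h.contDiffOn.clm_apply contDiffOn_const).clm_comp contDiffOn_const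
  refine ⟨fun x => ∫ t in (0 : ℝ)..1, f (x, t), contDiffOn_intervalIntegral hU hf,
    fun p hp u v => ?_⟩
  have mem (t : ℝ) : (p, t) ∈ U ×ˢ (univ : Set ℝ) := ⟨hp, mem_univ t⟩
  have slice : Continuous fun t : ℝ => fderiv ℝ f (p, t) :=
    (hf.continuousOn_fderiv_of_isOpen hV (by simp)).comp_prodMk hp
  have cont (a b c : E × ℝ) : Continuous fun t : ℝ => fderiv ℝ (fun q => Ω q b c) (p, t) a :=
    (((h.contDiffOn_apply b c).continuousOn_fderiv_of_isOpen hV (by simp)).comp_prodMk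
      hp).clm_apply continuous_const
  have df (t : ℝ) (u v : E) :
      fderiv ℝ f (p, t) (u, 0) v = fderiv ℝ (fun q => Ω q (0, 1) (v, 0)) (p, t) (u, 0) := by
    have h1 := (((hf.contDiffAt (hV.mem_nhds (mem t))).differentiableAt
      (by simp)).hasFDerivAt).clm_apply (hasFDerivAt_const v (p, t))
    have h2 : fderiv ℝ (fun q => Ω q (0, 1) (v, 0)) (p, t) = _ := h1.fderiv
    rw [h2]
    simp
  have int_eq (u v : E) : fderiv ℝ (fun x => ∫ t in (0 : ℝ)..1, f (x, t)) p u v =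
      ∫ t in (0 : ℝ)..1, fderiv ℝ (fun q => Ω q (0, 1) (v, 0)) (p, t) (u, 0) := by
    have hc : Continuous fun t : ℝ => (fderiv ℝ f (p, t)).comp (.inl ℝ E ℝ) :=
      slice.clm_comp continuous_const
    rw [(hasFDerivAt_intervalIntegral_of_contDiffOn hU hf hp).fderiv,
      ContinuousLinearMap.intervalIntegral_apply (hc.intervalIntegrable _ _),
      ContinuousLinearMap.intervalIntegral_apply
        ((hc.clm_apply continuous_const).intervalIntegrable _ _)]
    simp [df]
  have dt (t : ℝ) : HasDerivAt (fun t => Ω (p, t) (u, 0) (v, 0))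
      (fderiv ℝ (fun q => Ω q (u, 0) (v, 0)) (p, t) (0, 1)) t := by
    have h1 := ((((h.contDiffOn_apply (u, 0) (v, 0)).contDiffAt
      (hV.mem_nhds (mem t))).differentiableAt (by simp)).hasFDerivAt).comp (f := fun t => (p, t)) t
      (hasFDerivAt_prodMk_right p t)
    simpa [Function.comp_def] using h1.hasDerivAt
  rw [int_eq, int_eq, ← intervalIntegral.integral_sub ((cont _ _ _).intervalIntegrable _ _)
    ((cont _ _ _).intervalIntegrable _ _), ← intervalIntegral.integral_eq_sub_of_hasDerivAt
    (fun t _ => dt t) ((cont _ _ _).intervalIntegrable _ _)]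
  refine intervalIntegral.integral_congr fun t _ => ?_
  have c := h.closed (p, t) (mem t) (u, 0) (0, 1) (v, 0)
  have a := h.fderiv_antisymm hV (mem t)
  rw [a (v, 0) (u, 0), a (u, 0) (0, 1)] at c
  simp only [neg_apply] at c
  linarith

end IsClosedTwoForm

theorem exists_continuous_ball_subset {α E : Type*} [TopologicalSpace α] [NormedAddCommGroup E]
    {U : Set E} (hU : IsOpen U) {f : α → E} (hf : Continuous f) (hfU : ∀ x, f x ∈ U) :
    ∃ ε : α → ℝ, Continuous ε ∧ (∀ x, 0 < ε x) ∧ ∀ x y, dist y (f x) < ε x → y ∈ U := by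
  rcases eq_empty_or_nonempty Uᶜ with h | h
  · exact ⟨fun _ => 1, continuous_const, fun _ => one_pos, fun _ y _ => by simp_all⟩
  · refine ⟨fun x => Metric.infDist (f x) Uᶜ, (Metric.continuous_infDist_pt _).comp hf,
      fun x => (hU.isClosed_compl.notMem_iff_infDist_pos h).1 fun hx => hx (hfU x),
      fun x y hy => ?_⟩
    by_contra hyU
    exact absurd (Metric.infDist_le_dist_of_mem (x := f x) (show y ∈ Uᶜ from hyU))
      (by rw [dist_comm]; exact not_le.2 hy)

theorem exists_smooth_contraction {E : Type*} [NormedAddCommGroup E] [NormedSpace ℝ E]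
    [FiniteDimensional ℝ E] {U : Set E} (hU : IsOpen U) [ContractibleSpace U] :
    ∃ (G : E × ℝ → E) (y : E), ContDiffOn ℝ ∞ G (U ×ˢ univ) ∧ MapsTo G (U ×ˢ univ) U ∧
      ∀ p ∈ U, G (p, 0) = y ∧ G (p, 1) = p := by
  obtain ⟨y, ⟨H⟩⟩ := id_nullhomotopic U
  let V : TopologicalSpace.Opens (E × ℝ) := ⟨U ×ˢ univ, hU.prod isOpen_univ⟩
  have : ProperSpace E := FiniteDimensional.proper ℝ E
  have : LocallyCompactSpace V := V.2.locallyCompactSpace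
  have : SigmaCompactSpace V := inferInstance
  let f : V → E := fun q => H (projIcc 0 1 zero_le_one (2 - 3 * q.1.2), ⟨q.1.1, q.2.1⟩)
  have hf : Continuous f := by
    refine continuous_subtype_val.comp (H.continuous.comp ?_)
    exact (continuous_projIcc.comp (by fun_prop)).prodMk (Continuous.subtype_mk (by fun_prop) _)
  have hf0 (q : V) (hq : q.1.2 < 1 / 3) : f q = y := by
    have : projIcc (0 : ℝ) 1 zero_le_one (2 - 3 * q.1.2) = 1 :=
      projIcc_of_right_le _ (by linarith)
    simp only [f, this, H.apply_one, ContinuousMap.const_apply]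
  have hf1 (q : V) (hq : 2 / 3 < q.1.2) : f q = q.1.1 := by
    have : projIcc (0 : ℝ) 1 zero_le_one (2 - 3 * q.1.2) = 0 :=
      projIcc_of_le_left _ (by linarith)
    simp only [f, this, H.apply_zero, ContinuousMap.id_apply]
  obtain ⟨ε, ε_cont, ε_pos, hε⟩ := exists_continuous_ball_subset hU hf fun q => Subtype.prop _
  have hsnd : Continuous fun q : V => q.1.2 := by fun_prop
  have hN0 : IsOpen {q : V | q.1.2 < 1 / 3} := isOpen_lt hsnd continuous_const
  have hN1 : IsOpen {q : V | 2 / 3 < q.1.2} := isOpen_lt continuous_const hsnd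
  have hfN : ContMDiffOn 𝓘(ℝ, E × ℝ) 𝓘(ℝ, E) ∞ f
      ({q : V | q.1.2 < 1 / 3} ∪ {q : V | 2 / 3 < q.1.2}) := by
    rintro q (hq | hq)
    · refine ContMDiffAt.contMDiffWithinAt (ContMDiffAt.congr_of_eventuallyEq
        (contMDiffAt_const (c := (y : E))) ?_)
      exact Filter.eventually_of_mem (hN0.mem_nhds hq) hf0
    · refine ContMDiffAt.contMDiffWithinAt (ContMDiffAt.congr_of_eventuallyEq
        (f := fun q : V => q.1.1) ?_ ?_)
      · exact contMDiffAt_subtype_iff.2 contDiff_fst.contMDiff.contMDiffAt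
      · exact Filter.eventually_of_mem (hN1.mem_nhds hq) hf1
  obtain ⟨g, hgε, hgS, -⟩ := hf.exists_contMDiff_approx_and_eqOn 𝓘(ℝ, E × ℝ) ⊤ ε_cont ε_pos
    (S := {q : V | q.1.2 ≤ 0} ∪ {q : V | 1 ≤ q.1.2})
    ((isClosed_le hsnd continuous_const).union (isClosed_le continuous_const hsnd))
    ((hN0.union hN1).mem_nhdsSet.2 (union_subset_union
      (fun q hq => lt_of_le_of_lt (mem_ofPred.1 hq) (by norm_num))
      fun q hq => lt_of_lt_of_le (by norm_num) (mem_ofPred.1 hq))) hfN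
  classical
  let G : E × ℝ → E := fun q => if h : q ∈ V then g ⟨q, h⟩ else 0
  have hG (q : V) : G q = g q := dif_pos q.2
  refine ⟨G, y, fun q hq => ?_, fun q hq => ?_, fun p hp => ⟨?_, ?_⟩⟩
  · have h1 : ContMDiffAt 𝓘(ℝ, E × ℝ) 𝓘(ℝ, E) ∞ (fun q : V => G q) ⟨q, hq⟩ := by
      simp only [hG]
      exact g.contMDiff.contMDiffAt
    exact (contMDiffAt_subtype_iff.1 h1).contDiffAt.contDiffWithinAt
  · rw [hG ⟨q, hq⟩]
    exact hε _ _ (hgε _)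
  · rw [hG ⟨(p, 0), hp, mem_univ _⟩, hgS (Or.inl (le_refl (0 : ℝ)))]
    exact hf0 _ (by norm_num)
  · rw [hG ⟨(p, 1), hp, mem_univ _⟩, hgS (Or.inr (le_refl (1 : ℝ)))]
    exact hf1 _ (by norm_num)

theorem IsClosedTwoForm.exists_primitive {E : Type u} [NormedAddCommGroup E] [NormedSpace ℝ E]
    [FiniteDimensional ℝ E] {U : Set E} (hU : IsOpen U) [ContractibleSpace U]
    {σ : E → E →L[ℝ] E →L[ℝ] ℝ} (h : IsClosedTwoForm σ U) :
    ∃ η : E → E →L[ℝ] ℝ, ContDiffOn ℝ ∞ η U ∧ ∀ p ∈ U, ∀ u v,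
      fderiv ℝ η p u v - fderiv ℝ η p v u = σ p u v := by
  obtain ⟨G, y, hG, hGU, hGy⟩ := exists_smooth_contraction hU
  have hV : IsOpen (U ×ˢ (univ : Set ℝ)) := hU.prod isOpen_univ
  obtain ⟨η, hη, hdη⟩ := (h.pullback hU hV hG hGU).exists_primitive_of_cylinder hU
  refine ⟨η, hη, fun p hp u v => ?_⟩
  have dG (t : ℝ) (w : E) : fderiv ℝ G (p, t) (w, 0) = fderiv ℝ (fun x => G (x, t)) p w := by
    have h1 := ((hG.contDiffAt (hV.mem_nhds ⟨hp, mem_univ t⟩)).differentiableAt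
      (by simp)).hasFDerivAt.comp (f := fun x => (x, t)) p (hasFDerivAt_prodMk_left p t)
    have h2 : fderiv ℝ (fun x => G (x, t)) p = _ := h1.fderiv
    rw [h2]
    simp
  have d0 : fderiv ℝ (fun x => G (x, 0)) p = 0 := by
    rw [Filter.EventuallyEq.fderiv_eq (f := fun _ => y)
      (Filter.eventually_of_mem (hU.mem_nhds hp) fun x hx => (hGy x hx).1)]
    simp
  have d1 : fderiv ℝ (fun x => G (x, 1)) p = .id ℝ E := by
    rw [Filter.EventuallyEq.fderiv_eq (f := fun x => x)
      (Filter.eventually_of_mem (hU.mem_nhds hp) fun x hx => (hGy x hx).2)]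
    simp
  rw [hdη p hp]
  simp [dG, d0, d1, (hGy p hp).2]

theorem ContDiffOn.smul_vec {E F : Type*} [NormedAddCommGroup E] [NormedSpace ℝ E]
    [NormedAddCommGroup F] [NormedSpace ℝ F] {f : E → ℝ} {s : Set E}
    (hf : ContDiffOn ℝ ∞ f s) (v : F) : ContDiffOn ℝ ∞ (fun p => f p • v) s :=
  hf.smul contDiffOn_const

section Engel

variable {U : Set (Fin 4 → ℝ)} {f g : (Fin 4 → ℝ) → ℝ} {p : Fin 4 → ℝ}

theorem ContDiffOn.fderiv_field {n : ℕ} {U : Set (Fin n → ℝ)} {f : (Fin n → ℝ) → ℝ}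
    (hU : IsOpen U) (hf : ContDiffOn ℝ ∞ f U) {V : (Fin n → ℝ) → Fin n → ℝ}
    (hV : ContDiff ℝ ∞ V) : ContDiffOn ℝ ∞ (fun p => fderiv ℝ f p (V p)) U :=
  (hf.fderiv_of_isOpen hU (by simp)).clm_apply hV.contDiffOn

theorem contDiffOn_opX (hU : IsOpen U) (hf : ContDiffOn ℝ ∞ f U) : ContDiffOn ℝ ∞ (opX f) U :=
  hf.fderiv_field hU contDiff_const

theorem contDiffOn_opY (hU : IsOpen U) (hf : ContDiffOn ℝ ∞ f U) : ContDiffOn ℝ ∞ (opY f) U :=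
  hf.fderiv_field hU (contDiff_pi.2 fun i => by fin_cases i <;> simp <;> fun_prop)

theorem contDiffOn_opZ (hU : IsOpen U) (hf : ContDiffOn ℝ ∞ f U) : ContDiffOn ℝ ∞ (opZ f) U :=
  hf.fderiv_field hU (contDiff_pi.2 fun i => by fin_cases i <;> simp <;> fun_prop)

theorem opX_eq : opX f p = fderiv ℝ f p (Pi.single 0 1) := by
  unfold opX
  congr 1
  ext i
  fin_cases i <;> simp

theorem opY_eq : opY f p = p 0 ^ 2 * fderiv ℝ f p (Pi.single 1 1) +
    fderiv ℝ f p (Pi.single 2 1) + p 0 * fderiv ℝ f p (Pi.single 3 1) := by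
  simp only [opY, ← smul_eq_mul, ← map_smul, ← map_add]
  congr 1
  ext i
  fin_cases i <;> simp

theorem opZ_eq : opZ f p = 2 * p 0 * fderiv ℝ f p (Pi.single 1 1) +
    fderiv ℝ f p (Pi.single 3 1) := by
  simp only [opZ, ← smul_eq_mul, ← map_smul, ← map_add]
  congr 1
  ext i
  fin_cases i <;> simp

theorem opW_eq : opW f p = 2 * fderiv ℝ f p (Pi.single 1 1) := by
  simp only [opW, ← smul_eq_mul, ← map_smul]
  congr 1
  ext i
  fin_cases i <;> simp

theorem opX_add (hf : DifferentiableAt ℝ f p) (hg : DifferentiableAt ℝ g p) :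
    opX (fun q => f q + g q) p = opX f p + opX g p := by
  simp only [opX, fderiv_fun_add hf hg, add_apply]

theorem opY_add (hf : DifferentiableAt ℝ f p) (hg : DifferentiableAt ℝ g p) :
    opY (fun q => f q + g q) p = opY f p + opY g p := by
  simp only [opY, fderiv_fun_add hf hg, add_apply]

theorem opX_congr (hU : IsOpen U) (h : EqOn f g U) : EqOn (opX f) (opX g) U := fun p hp => by
  simp only [opX, (h.eventuallyEq_of_mem (hU.mem_nhds hp)).fderiv_eq]

theorem opY_congr (hU : IsOpen U) (h : EqOn f g U) : EqOn (opY f) (opY g) U := fun p hp => by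
  simp only [opY, (h.eventuallyEq_of_mem (hU.mem_nhds hp)).fderiv_eq]

/-- The constant 2-form `dxᵢ ∧ dxⱼ` on `ℝ⁴`. -/
noncomputable def wedge (i j : Fin 4) : (Fin 4 → ℝ) →L[ℝ] (Fin 4 → ℝ) →L[ℝ] ℝ :=
  (ContinuousLinearMap.proj i : (Fin 4 → ℝ) →L[ℝ] ℝ).smulRight
      (ContinuousLinearMap.proj j : (Fin 4 → ℝ) →L[ℝ] ℝ) -
    (ContinuousLinearMap.proj j : (Fin 4 → ℝ) →L[ℝ] ℝ).smulRight
      (ContinuousLinearMap.proj i : (Fin 4 → ℝ) →L[ℝ] ℝ)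

theorem wedge_apply (i j : Fin 4) (u v : Fin 4 → ℝ) : wedge i j u v = u i * v j - u j * v i := by
  simp [wedge]

/-- The 2-form whose nonzero components in the frame `X, Y, Z, W` are `(X, W) ↦ c`,
`(Y, Z) ↦ -d`, `(Y, W) ↦ m` and `(Z, W) ↦ n`. -/
noncomputable def engelForm (c d m n : (Fin 4 → ℝ) → ℝ) (p : Fin 4 → ℝ) :
    (Fin 4 → ℝ) →L[ℝ] (Fin 4 → ℝ) →L[ℝ] ℝ :=
  (c p / 2) • wedge 0 1 + (c p * p 0 ^ 2 / 2) • wedge 0 2 - (c p * p 0) • wedge 0 3 +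
    (p 0 * n p / 2 - m p / 2) • wedge 1 2 - (n p / 2) • wedge 1 3 +
    (-d p - m p * p 0 + n p * p 0 ^ 2 / 2) • wedge 2 3

theorem clm_apply_eq_sum_basis (L : (Fin 4 → ℝ) →L[ℝ] ℝ) (u : Fin 4 → ℝ) :
    L u = u 0 * L (Pi.single 0 1) + u 1 * L (Pi.single 1 1) + u 2 * L (Pi.single 2 1) +
      u 3 * L (Pi.single 3 1) := by
  simp only [← smul_eq_mul, ← map_smul, ← map_add]
  congr 1
  ext i
  fin_cases i <;> simp

theorem isClosedTwoForm_engelForm (hU : IsOpen U) {c d m n : (Fin 4 → ℝ) → ℝ}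
    (hc : ContDiffOn ℝ ∞ c U) (hd : ContDiffOn ℝ ∞ d U)
    (hm : ContDiffOn ℝ ∞ m U) (hn : ContDiffOn ℝ ∞ n U)
    (hdm : ∀ p ∈ U, opX d p + m p = 0) (hmn : ∀ p ∈ U, n p = opX m p - opY c p)
    (h1 : ∀ p ∈ U, opX n p - opZ c p = 0)
    (h2 : ∀ p ∈ U, opY n p - opZ m p - opW d p = 0) :
    IsClosedTwoForm (engelForm c d m n) U := by
  have hx : ContDiffOn ℝ ∞ (fun p : Fin 4 → ℝ => p 0) U := by fun_prop
  refine ⟨?_, fun p hp u => ?_, fun p hp u v w => ?_⟩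
  · exact ((((((hc.div_const 2).smul_vec (wedge 0 1)).add
      (((hc.mul (hx.pow 2)).div_const 2).smul_vec (wedge 0 2))).sub
      ((hc.mul hx).smul_vec (wedge 0 3))).add
      ((((hx.mul hn).div_const 2).sub (hm.div_const 2)).smul_vec (wedge 1 2))).sub
      ((hn.div_const 2).smul_vec (wedge 1 3))).add
      (((hd.neg.sub (hm.mul hx)).add ((hn.mul (hx.pow 2)).div_const 2)).smul_vec (wedge 2 3))
  · simp [engelForm, wedge_apply, mul_comm]
  · have hasD {f : (Fin 4 → ℝ) → ℝ} (hf : ContDiffOn ℝ ∞ f U) : HasFDerivAt f (fderiv ℝ f p) p :=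
      ((hf.contDiffAt (hU.mem_nhds hp)).differentiableAt (by simp)).hasFDerivAt
    have dx : HasFDerivAt (fun p : Fin 4 → ℝ => p 0)
      (ContinuousLinearMap.proj 0 : (Fin 4 → ℝ) →L[ℝ] ℝ) p := hasFDerivAt_apply 0 p
    have dc := hasD hc
    have dd := hasD hd
    have dm := hasD hm
    have dn := hasD hn
    have key (u v w : Fin 4 → ℝ) : fderiv ℝ (fun q => engelForm c d m n q v w) p u =
        (fderiv ℝ c p u / 2) * wedge 0 1 v w
        + (fderiv ℝ c p u * p 0 ^ 2 / 2 + c p * p 0 * u 0) * wedge 0 2 v w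
        - (fderiv ℝ c p u * p 0 + c p * u 0) * wedge 0 3 v w
        + (u 0 * n p / 2 + p 0 * fderiv ℝ n p u / 2 - fderiv ℝ m p u / 2) * wedge 1 2 v w
        - (fderiv ℝ n p u / 2) * wedge 1 3 v w
        + (-fderiv ℝ d p u - fderiv ℝ m p u * p 0 - m p * u 0
            + fderiv ℝ n p u * p 0 ^ 2 / 2 + n p * p 0 * u 0) * wedge 2 3 v w := by
      have D := (((((((dc.mul_const 2⁻¹).mul_const (wedge 0 1 v w)).add
        (((dc.mul (dx.pow 2)).mul_const 2⁻¹).mul_const (wedge 0 2 v w))).sub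
        ((dc.mul dx).mul_const (wedge 0 3 v w))).add
        ((((dx.mul dn).mul_const 2⁻¹).sub (dm.mul_const 2⁻¹)).mul_const (wedge 1 2 v w))).sub
        ((dn.mul_const 2⁻¹).mul_const (wedge 1 3 v w))).add
        (((dd.neg.sub (dm.mul dx)).add ((dn.mul (dx.pow 2)).mul_const 2⁻¹)).mul_const
          (wedge 2 3 v w)))
      have e : fderiv ℝ (fun q => engelForm c d m n q v w) p = _ := D.fderiv
      rw [e]
      simp
      ring
    rw [key, key, key]
    have e1 := hdm p hp
    have e2 := hmn p hp
    have e3 := h1 p hp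
    have e4 := h2 p hp
    rw [opX_eq] at e1 e3
    rw [opX_eq, opY_eq] at e2
    rw [opZ_eq] at e3
    rw [opY_eq, opZ_eq, opW_eq] at e4
    simp only [wedge_apply, clm_apply_eq_sum_basis (fderiv ℝ _ p) u,
      clm_apply_eq_sum_basis (fderiv ℝ _ p) v, clm_apply_eq_sum_basis (fderiv ℝ _ p) w]
    generalize fderiv ℝ c p = c' at *
    generalize fderiv ℝ d p = d' at *
    generalize fderiv ℝ m p = m' at *
    generalize fderiv ℝ n p = n' at *
    linear_combination
      -(u 0 * (v 2 * w 3 - v 3 * w 2) - v 0 * (u 2 * w 3 - u 3 * w 2) +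
        w 0 * (u 2 * v 3 - u 3 * v 2)) * e1 +
      ((u 0 * (v 1 * w 2 - v 2 * w 1) - v 0 * (u 1 * w 2 - u 2 * w 1) +
        w 0 * (u 1 * v 2 - u 2 * v 1)) / 2 + p 0 *
        (u 0 * (v 2 * w 3 - v 3 * w 2) - v 0 * (u 2 * w 3 - u 3 * w 2) +
        w 0 * (u 2 * v 3 - u 3 * v 2))) * e2 +
      (p 0 * (u 0 * (v 1 * w 2 - v 2 * w 1) - v 0 * (u 1 * w 2 - u 2 * w 1) +
        w 0 * (u 1 * v 2 - u 2 * v 1)) -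
        (u 0 * (v 1 * w 3 - v 3 * w 1) - v 0 * (u 1 * w 3 - u 3 * w 1) +
        w 0 * (u 1 * v 3 - u 3 * v 1)) +
        p 0 ^ 2 * (u 0 * (v 2 * w 3 - v 3 * w 2) - v 0 * (u 2 * w 3 - u 3 * w 2) +
        w 0 * (u 2 * v 3 - u 3 * v 2))) / 2 * e3 +
      (u 1 * (v 2 * w 3 - v 3 * w 2) - v 1 * (u 2 * w 3 - u 3 * w 2) +
        w 1 * (u 2 * v 3 - u 3 * v 2)) / 2 * e4

end Engel

theorem engel_exact_degree_two
    (U : Set (Fin 4 → ℝ)) (hU : IsOpen U) (hUc : ContractibleSpace U)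
    (c d : (Fin 4 → ℝ) → ℝ)
    (hc : ContDiffOn ℝ (⊤ : ℕ∞) c U) (hd : ContDiffOn ℝ (⊤ : ℕ∞) d U)
    (h1 : ∀ p ∈ U, opX (opX (opX d)) p + (opX (opY c) p + opZ c p) = 0)
    (h2 : ∀ p ∈ U, opY (opY c) p +
            (opY (opX (opX d)) p - opZ (opX d) p + opW d p) = 0) :
    ∃ a b : (Fin 4 → ℝ) → ℝ, ContDiffOn ℝ (⊤ : ℕ∞) a U ∧ ContDiffOn ℝ (⊤ : ℕ∞) b U ∧
      ∀ p ∈ U,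
        c p = opX (opX (opX b)) p -
                (opX (opX (opY a)) p + opX (opZ a) p + opW a p) ∧
        d p = opY (opY a) p - (opY (opX b) p - opZ b p) := by
  have diff {f : (Fin 4 → ℝ) → ℝ} (hf : ContDiffOn ℝ ∞ f U) {p : Fin 4 → ℝ} (hp : p ∈ U) :
      DifferentiableAt ℝ f p :=
    (hf.contDiffAt (hU.mem_nhds hp)).differentiableAt (by simp)
  have hXd := contDiffOn_opX hU hd
  have hXXd := contDiffOn_opX hU hXd
  have hYc := contDiffOn_opY hU hc
  have hσ : IsClosedTwoForm
      (engelForm c d (fun p => -opX d p) (fun p => -opX (opX d) p - opY c p)) U := by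
    refine isClosedTwoForm_engelForm hU hc hd hXd.neg (hXXd.neg.sub hYc) (fun p _ => by simp)
      (fun p _ => ?_) (fun p hp => ?_) (fun p hp => ?_)
    · have e : opX (fun p => -opX d p) p = -opX (opX d) p := by
        unfold opX at *
        rw [fderiv_fun_neg]
        simp
      rw [e]
    · have e : opX (fun p => -opX (opX d) p - opY c p) p =
          -opX (opX (opX d)) p - opX (opY c) p := by
        unfold opX at *
        rw [fderiv_fun_sub (diff hXXd.neg hp) (diff hYc hp), fderiv_fun_neg]
        simp
      linear_combination e - h1 p hp
    · have e : opY (fun p => -opX (opX d) p - opY c p) p =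
          -opY (opX (opX d)) p - opY (opY c) p := by
        unfold opY at *
        rw [fderiv_fun_sub (diff hXXd.neg hp) (diff hYc hp), fderiv_fun_neg]
        simp
      have e' : opZ (fun p => -opX d p) p = -opZ (opX d) p := by simp [opZ]
      linear_combination e - e' - h2 p hp
  obtain ⟨η, hη, hdη⟩ := hσ.exists_primitive hU
  obtain ⟨q, hq, hdq⟩ : ∃ q : Fin 4 → (Fin 4 → ℝ) → ℝ, (∀ i, ContDiffOn ℝ ∞ (q i) U) ∧
      ∀ i j, ∀ p ∈ U, fderiv ℝ (q j) p (Pi.single i 1) - fderiv ℝ (q i) p (Pi.single j 1) =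
        engelForm c d (fun p => -opX d p) (fun p => -opX (opX d) p - opY c p) p
          (Pi.single i 1) (Pi.single j 1) := by
    refine ⟨fun i p => η p (Pi.single i 1), fun i => hη.clm_apply contDiffOn_const,
      fun i j p hp => ?_⟩
    have hp' := (hη.contDiffAt (hU.mem_nhds hp)).differentiableAt (by simp)
    rw [← hdη p hp, fderiv_clm_apply hp' (differentiableAt_const _),
      fderiv_clm_apply hp' (differentiableAt_const _)]
    simp
  simp only [engelForm, add_apply, sub_apply, smul_apply, wedge_apply, smul_eq_mul] at hdq
  have hx : ContDiffOn ℝ ∞ (fun p : Fin 4 → ℝ => p 0) U := by fun_prop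
  obtain ⟨b, hb⟩ : ∃ b : (Fin 4 → ℝ) → ℝ, b = fun p => p 0 ^ 2 * q 1 p + q 2 p + p 0 * q 3 p :=
    ⟨_, rfl⟩
  obtain ⟨e, he⟩ : ∃ e : (Fin 4 → ℝ) → ℝ, e = fun p => 2 * p 0 * q 1 p + q 3 p := ⟨_, rfl⟩
  have hbs : ContDiffOn ℝ ∞ b U := by
    rw [hb]
    exact (((hx.pow 2).mul (hq 1)).add (hq 2)).add (hx.mul (hq 3))
  have hes : ContDiffOn ℝ ∞ e U := by
    rw [he]
    exact ((contDiffOn_const.mul hx).mul (hq 1)).add (hq 3)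
  have hfs : ContDiffOn ℝ ∞ (fun p => 2 * q 1 p) U := contDiffOn_const.mul (hq 1)
  have dx (p : Fin 4 → ℝ) : HasFDerivAt (fun p : Fin 4 → ℝ => p 0)
    (ContinuousLinearMap.proj 0 : (Fin 4 → ℝ) →L[ℝ] ℝ) p := hasFDerivAt_apply 0 p
  have db {p : Fin 4 → ℝ} (hp : p ∈ U) (v : Fin 4 → ℝ) : fderiv ℝ b p v =
      2 * p 0 * v 0 * q 1 p + p 0 ^ 2 * fderiv ℝ (q 1) p v + fderiv ℝ (q 2) p v +
        v 0 * q 3 p + p 0 * fderiv ℝ (q 3) p v := by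
    have D := ((((dx p).pow 2).mul (diff (hq 1) hp).hasFDerivAt).add
      (diff (hq 2) hp).hasFDerivAt).add ((dx p).mul (diff (hq 3) hp).hasFDerivAt)
    rw [(congrArg (fderiv ℝ · p) hb).trans D.fderiv]
    simp
    ring
  have de {p : Fin 4 → ℝ} (hp : p ∈ U) (v : Fin 4 → ℝ) : fderiv ℝ e p v =
      2 * v 0 * q 1 p + 2 * p 0 * fderiv ℝ (q 1) p v + fderiv ℝ (q 3) p v := by
    have D := (((dx p).const_mul 2).mul (diff (hq 1) hp).hasFDerivAt).add
      (diff (hq 3) hp).hasFDerivAt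
    rw [(congrArg (fderiv ℝ · p) he).trans D.fderiv]
    simp
    ring
  have df {p : Fin 4 → ℝ} (hp : p ∈ U) (v : Fin 4 → ℝ) :
      fderiv ℝ (fun p => 2 * q 1 p) p v = 2 * fderiv ℝ (q 1) p v := by
    rw [fderiv_const_mul (diff (hq 1) hp)]
    simp
  have hXb : EqOn (opX b) (fun p => opY (q 0) p + e p) U := fun p hp => by
    have r1 := hdq 0 1 p hp
    have r2 := hdq 0 2 p hp
    have r3 := hdq 0 3 p hp
    simp at r1 r2 r3
    simp only [opX_eq, opY_eq, db hp, he]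
    simp
    linear_combination p 0 ^ 2 * r1 + r2 + p 0 * r3
  have hXe : EqOn (opX e) (fun p => opZ (q 0) p + 2 * q 1 p) U := fun p hp => by
    have r1 := hdq 0 1 p hp
    have r3 := hdq 0 3 p hp
    simp at r1 r3
    simp only [opX_eq, opZ_eq, de hp]
    simp
    linear_combination 2 * p 0 * r1 + r3
  have hXf : ∀ p ∈ U, opX (fun p => 2 * q 1 p) p = opW (q 0) p + c p := fun p hp => by
    have r1 := hdq 0 1 p hp
    simp at r1
    simp only [opX_eq, opW_eq, df hp]
    linear_combination 2 * r1
  have hYe : ∀ p ∈ U, opY e p = opZ b p - d p := fun p hp => by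
    have r12 := hdq 1 2 p hp
    have r13 := hdq 1 3 p hp
    have r23 := hdq 2 3 p hp
    simp at r12 r13 r23
    simp only [opY_eq, opZ_eq, db hp, de hp]
    simp
    linear_combination r23 - 2 * p 0 * r12 - p 0 ^ 2 * r13
  have hYa := contDiffOn_opY hU (hq 0)
  have hZa := contDiffOn_opZ hU (hq 0)
  refine ⟨q 0, b, hq 0, hbs, fun p hp => ⟨?_, ?_⟩⟩
  · have hXXb : EqOn (opX (opX b)) (fun p => opX (opY (q 0)) p + opZ (q 0) p + 2 * q 1 p) U :=
      fun p hp => by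
        rw [opX_congr hU hXb hp, opX_add (diff hYa hp) (diff hes hp), hXe hp]
        exact (add_assoc _ _ _).symm
    rw [opX_congr hU hXXb hp,
      opX_add ((diff (contDiffOn_opX hU hYa) hp).fun_add (diff hZa hp)) (diff hfs hp),
      opX_add (diff (contDiffOn_opX hU hYa) hp) (diff hZa hp), hXf p hp]
    ring
  · rw [opY_congr hU hXb hp, opY_add (diff hYa hp) (diff hes hp), hYe p hp]
    ring
end
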